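/- Let 𝓗 be a well-structured preconditioner set in dimension d, let t ≥ 1, let g_1,…,g_t ∈ ℝ^d, and let G = [g_1 … g_t] ∈ ℝ^{d×t} be the matrix with columns g_s. For W ∈ ℝ^{d×t} define N(W) := sup{√(Tr(Wᵀ H W)) : H ∈ 𝓗, t·Tr(H) ≤ 1}. Then inf{√(Σ_{s=1}^t g_sᵀ H⁻¹ g_s) : H ∈ 𝓗 positive definite, Tr(H) ≤ 1} = (1/√t)·sup{Tr(Gᵀ W) : W ∈ ℝ^{d×t}, N(W) ≤ 1}. -/

import Mathlib

open Matrix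

/-- A set of real `d × d` matrices closed under scalar multiplication, addition and
matrix multiplication, containing the identity. -/
def IsMatrixSubalgebra {d : ℕ} (K : Set (Matrix (Fin d) (Fin d) ℝ)) : Prop :=
  (∀ (c : ℝ), ∀ A ∈ K, c • A ∈ K) ∧ (∀ A ∈ K, ∀ B ∈ K, A + B ∈ K) ∧
    (∀ A ∈ K, ∀ B ∈ K, A * B ∈ K) ∧ (1 : Matrix (Fin d) (Fin d) ℝ) ∈ K

/-- A well-structured preconditioner set: `𝓗 = 𝒦 ∩ S₊^d` for a matrix subalgebra `𝒦`. -/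
def WellStructured {d : ℕ} (𝓗 : Set (Matrix (Fin d) (Fin d) ℝ)) : Prop :=
  ∃ K : Set (Matrix (Fin d) (Fin d) ℝ),
    IsMatrixSubalgebra K ∧ 𝓗 = K ∩ {M | M.PosSemidef}

/-- `⟨A,B⟩ := Tr(Aᵀ B)` for square real matrices. -/
noncomputable def minner {n : Type*} [Fintype n] (A B : Matrix n n ℝ) : ℝ := (Aᵀ * B).trace

/-- Inversion of real matrices is continuous at every matrix of nonzero determinant. -/
theorem continuousAt_matrix_inv_of_det_ne_zero {n : Type*} [Fintype n] [DecidableEq n]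
    {A : Matrix n n ℝ} (hA : A.det ≠ 0) : ContinuousAt (fun B : Matrix n n ℝ => B⁻¹) A :=
  continuousAt_matrix_inv A (by simpa [Ring.inverse_eq_inv'] using continuousAt_inv₀ hA)

/-- The set of positive semidefinite real matrices is closed. -/
theorem isClosed_setOf_posSemidef {n : Type*} [Fintype n] :
    IsClosed {M : Matrix n n ℝ | M.PosSemidef} := by
  have h : {M : Matrix n n ℝ | M.PosSemidef} =
      {M | Mᵀ = M} ∩ ⋂ x : n → ℝ, {M | 0 ≤ x ⬝ᵥ M *ᵥ x} := by
    ext M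
    simp [Matrix.posSemidef_iff_dotProduct_mulVec, Matrix.IsHermitian]
  rw [h]
  refine (isClosed_eq (by fun_prop) continuous_id).inter (isClosed_iInter fun x => ?_)
  exact isClosed_le continuous_const (by fun_prop)

/-- The entries of a positive semidefinite real matrix are bounded by its trace. -/
theorem Matrix.PosSemidef.abs_apply_le_trace {n : Type*} [Fintype n] [DecidableEq n]
    {M : Matrix n n ℝ} (hM : M.PosSemidef) (i j : n) : |M i j| ≤ M.trace := by
  have hdiag : ∀ k, M k k ≤ M.trace := fun k =>
    Finset.single_le_sum (f := fun k => M k k) (fun l _ => hM.diag_nonneg) (Finset.mem_univ k)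
  have hsymm : M j i = M i j := by simpa using hM.1.apply i j
  have hquad : ∀ c : ℝ, 0 ≤ M i i + c * M i j + c * M j i + c * c * M j j := by
    intro c
    have h := hM.dotProduct_mulVec_nonneg (Pi.single i 1 + c • Pi.single j 1)
    simp [Matrix.mulVec_add, Matrix.mulVec_smul] at h
    linarith
  rw [abs_le]
  constructor <;> linarith [hquad 1, hquad (-1), hdiag i, hdiag j]

/-- The positive semidefinite matrices of trace at most one in a subspace form a compact set. -/
theorem Submodule.isCompact_posSemidef_trace_le_one {n : Type*} [Fintype n] [DecidableEq n]
    (K : Submodule ℝ (Matrix n n ℝ)) :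
    IsCompact {M : Matrix n n ℝ | M ∈ K ∧ M.PosSemidef ∧ M.trace ≤ 1} := by
  have hbox : IsCompact
      (Set.pi Set.univ fun _ : n => Set.pi Set.univ fun _ : n => Set.Icc (-1 : ℝ) 1) :=
    isCompact_univ_pi fun _ => isCompact_univ_pi fun _ => isCompact_Icc
  refine hbox.of_isClosed_subset ?_ ?_
  · have hK : IsClosed (K : Set (Matrix n n ℝ)) := K.closed_of_finiteDimensional
    exact hK.inter (isClosed_setOf_posSemidef.inter
      (isClosed_le continuous_id.matrix_trace continuous_const))
  · rintro M ⟨-, hM, htr⟩ i - j -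
    exact abs_le.1 ((hM.abs_apply_le_trace i j).trans htr)

theorem Matrix.PosSemidef.trace_transpose_mul_mul_nonneg {m n : Type*} [Fintype m] [Fintype n]
    {H : Matrix n n ℝ} (hH : H.PosSemidef) (W : Matrix n m ℝ) : 0 ≤ (Wᵀ * H * W).trace := by
  simpa using (hH.conjTranspose_mul_mul_same W).trace_nonneg

/-- Cauchy–Schwarz inequality for the trace pairing weighted by a positive definite matrix. -/
theorem Matrix.PosDef.trace_transpose_mul_sq_le {m n : Type*} [Fintype m] [Fintype n]
    [DecidableEq n] {A : Matrix n n ℝ} (hA : A.PosDef) (G W : Matrix n m ℝ) :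
    (Gᵀ * W).trace ^ 2 ≤ (Gᵀ * A⁻¹ * G).trace * (Wᵀ * A * W).trace := by
  have hdet : IsUnit A.det := hA.det_pos.ne'.isUnit
  have hsymm : Aᵀ = A := by simpa using hA.1.eq
  have hquad : ∀ c : ℝ, 0 ≤ (Wᵀ * A * W).trace * (c * c) + (-2 * (Gᵀ * W).trace) * c
      + (Gᵀ * A⁻¹ * G).trace := by
    intro c
    have h := hA.posSemidef.trace_transpose_mul_mul_nonneg (c • W - A⁻¹ * G)
    have hcomm : (Wᵀ * G).trace = (Gᵀ * W).trace := by
      rw [← Matrix.trace_transpose]; simp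
    have hexp : (c • W - A⁻¹ * G)ᵀ * A * (c • W - A⁻¹ * G) =
        (c * c) • (Wᵀ * A * W) - c • (Wᵀ * G) - c • (Gᵀ * W) + Gᵀ * A⁻¹ * G := by
      have h1 : A * (A⁻¹ * G) = G := Matrix.mul_nonsing_inv_cancel_left _ _ hdet
      have h2 : Gᵀ * A⁻¹ * A = Gᵀ := Matrix.nonsing_inv_mul_cancel_right _ _ hdet
      simp only [Matrix.transpose_sub, Matrix.transpose_smul, Matrix.transpose_mul,
        Matrix.transpose_nonsing_inv, hsymm, Matrix.sub_mul, Matrix.mul_sub, Matrix.smul_mul,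
        Matrix.mul_smul, h2, Matrix.mul_assoc Wᵀ A, h1, smul_sub,
        smul_smul, Matrix.mul_assoc Gᵀ A⁻¹]
      abel
    rw [hexp] at h
    simp only [Matrix.trace_add, Matrix.trace_sub, Matrix.trace_smul, smul_eq_mul, hcomm] at h
    linarith
  have h := discrim_le_zero hquad
  rw [discrim] at h
  nlinarith

open Filter Topology in
/-- First-order optimality for `B ↦ Tr(Gᵀ B⁻¹ G)` along the segment from `A` towards `A + D`. -/
theorem trace_mul_le_zero_of_forall_trace_inv_le {m n : Type*} [Fintype m] [Fintype n]
    [DecidableEq n] {A D : Matrix n n ℝ} {G : Matrix n m ℝ} (hA : A.det ≠ 0)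
    (hmin : ∀ s : ℝ, 0 < s → s ≤ 1 →
      (Gᵀ * A⁻¹ * G).trace ≤ (Gᵀ * (A + s • D)⁻¹ * G).trace) :
    (Gᵀ * A⁻¹ * D * A⁻¹ * G).trace ≤ 0 := by
  have hpath : Tendsto (fun s : ℝ => A + s • D) (𝓝[>] 0) (𝓝 A) := by
    have h : Continuous fun s : ℝ => A + s • D := by fun_prop
    simpa using (h.tendsto 0).mono_left nhdsWithin_le_nhds
  have hinv : Tendsto (fun s : ℝ => (A + s • D)⁻¹) (𝓝[>] 0) (𝓝 A⁻¹) :=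
    (continuousAt_matrix_inv_of_det_ne_zero hA).tendsto.comp hpath
  have hdet : ∀ᶠ s : ℝ in 𝓝[>] 0, (A + s • D).det ≠ 0 :=
    ((continuous_id.matrix_det.tendsto A).comp hpath).eventually_ne hA
  have hcont : Continuous fun B : Matrix n n ℝ => (Gᵀ * B * D * A⁻¹ * G).trace := by fun_prop
  refine le_of_tendsto ((hcont.tendsto _).comp hinv) ?_
  filter_upwards [hdet, Ioo_mem_nhdsGT (zero_lt_one' ℝ)] with s hs hs01
  have hres : (A + s • D)⁻¹ = A⁻¹ - s • ((A + s • D)⁻¹ * D * A⁻¹) := by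
    have h1 : (A + s • D)⁻¹ * (A + s • D) * A⁻¹ = A⁻¹ := by
      rw [Matrix.nonsing_inv_mul _ hs.isUnit, Matrix.one_mul]
    rw [Matrix.mul_add, Matrix.add_mul, Matrix.mul_assoc, Matrix.mul_nonsing_inv _ hA.isUnit,
      Matrix.mul_one, Matrix.mul_smul, Matrix.smul_mul] at h1
    exact eq_sub_of_add_eq h1
  have h := hmin s hs01.1 hs01.2.le
  rw [hres] at h
  simp only [Matrix.mul_sub, Matrix.sub_mul, Matrix.mul_smul, Matrix.smul_mul, Matrix.trace_sub,
    Matrix.trace_smul, smul_eq_mul, ← Matrix.mul_assoc] at h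
  have := hs01.1
  simp only [Function.comp_apply]
  nlinarith

/-- A regularised minimiser of `H ↦ Tr(Gᵀ H⁻¹ G)`, with the dual certificate `A⁻¹ G`. -/
theorem Submodule.exists_posDef_trace_inv_certificate {m n : Type*} [Fintype m] [Fintype n]
    [DecidableEq n] (K : Submodule ℝ (Matrix n n ℝ)) (hone : 1 ∈ K) (G : Matrix n m ℝ)
    {ε : ℝ} (hε : 0 < ε) :
    ∃ A ∈ K, A.PosDef ∧ A.trace ≤ 1 + ε * Fintype.card n ∧
      ∀ H ∈ K, H.PosSemidef → H.trace ≤ 1 →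
        ((A⁻¹ * G)ᵀ * H * (A⁻¹ * G)).trace ≤ (Gᵀ * A⁻¹ * G).trace := by
  have hpd : ∀ H : Matrix n n ℝ, H.PosSemidef → (H + ε • 1).PosDef := fun H hH =>
    Matrix.PosDef.posSemidef_add hH (Matrix.PosDef.one.smul hε)
  obtain ⟨H₀, ⟨hK₀, hH₀, htr₀⟩, hmin⟩ :=
    K.isCompact_posSemidef_trace_le_one.exists_isMinOn
      ⟨0, K.zero_mem, Matrix.PosSemidef.zero, by simp⟩
      (f := fun H => (Gᵀ * (H + ε • 1)⁻¹ * G).trace) (by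
        rintro H ⟨-, hH, -⟩
        refine ContinuousAt.continuousWithinAt ?_
        have hinv : ContinuousAt (fun H : Matrix n n ℝ => (H + ε • 1)⁻¹) H :=
          ContinuousAt.comp (f := fun H : Matrix n n ℝ => H + ε • 1)
            (continuousAt_matrix_inv_of_det_ne_zero (hpd H hH).det_pos.ne') (by fun_prop)
        have hcont : Continuous fun B : Matrix n n ℝ => (Gᵀ * B * G).trace := by fun_prop
        exact ContinuousAt.comp (f := fun H : Matrix n n ℝ => (H + ε • 1)⁻¹)
          hcont.continuousAt hinv)
  have hA := hpd H₀ hH₀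
  have hdet : IsUnit (H₀ + ε • (1 : Matrix n n ℝ)).det := hA.det_pos.ne'.isUnit
  have hsymm : (H₀ + ε • (1 : Matrix n n ℝ))ᵀ = H₀ + ε • 1 := by simpa using hA.1.eq
  refine ⟨H₀ + ε • 1, K.add_mem hK₀ (K.smul_mem ε hone), hA, ?_, fun H hK hH htr => ?_⟩
  · simpa [Matrix.trace_add] using htr₀
  have hopt := trace_mul_le_zero_of_forall_trace_inv_le (D := H - H₀) (G := G) hdet.ne_zero (by
    intro s hs0 hs1
    have hmem : (1 - s) • H₀ + s • H ∈
        {M : Matrix n n ℝ | M ∈ K ∧ M.PosSemidef ∧ M.trace ≤ 1} := by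
      refine ⟨K.add_mem (K.smul_mem _ hK₀) (K.smul_mem _ hK),
        (hH₀.smul (by linarith)).add (hH.smul hs0.le), ?_⟩
      simp only [Matrix.trace_add, Matrix.trace_smul, smul_eq_mul]
      nlinarith
    have hseg : (1 - s) • H₀ + s • H + ε • 1 = H₀ + ε • 1 + s • (H - H₀) := by
      module
    have h := hmin hmem
    simp only [Set.mem_ofPred_eq, hseg] at h
    exact h)
  generalize hAdef : H₀ + ε • (1 : Matrix n n ℝ) = A at *
  have htrans : (A⁻¹ * G)ᵀ = Gᵀ * A⁻¹ := by
    rw [Matrix.transpose_mul, Matrix.transpose_nonsing_inv, hsymm]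
  have hreg := Matrix.PosSemidef.one.trace_transpose_mul_mul_nonneg (A⁻¹ * G)
  have hsplit : (Gᵀ * A⁻¹ * G).trace = ((A⁻¹ * G)ᵀ * H₀ * (A⁻¹ * G)).trace +
      ε * ((A⁻¹ * G)ᵀ * (1 : Matrix n n ℝ) * (A⁻¹ * G)).trace := by
    have h : Gᵀ * A⁻¹ * G = Gᵀ * A⁻¹ * A * (A⁻¹ * G) := by
      rw [Matrix.nonsing_inv_mul_cancel_right _ _ hdet, Matrix.mul_assoc]
    rw [h, htrans]
    nth_rewrite 2 [← hAdef]
    rw [Matrix.mul_add, Matrix.add_mul, Matrix.trace_add, Matrix.mul_smul, Matrix.smul_mul,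
      Matrix.trace_smul, smul_eq_mul]
  rw [hsplit]
  simp only [Matrix.mul_sub, Matrix.sub_mul, Matrix.trace_sub, Matrix.mul_assoc] at hopt
  simp only [htrans, Matrix.mul_assoc] at hreg ⊢
  nlinarith [mul_nonneg hε.le hreg]

theorem stmt_5 {d : ℕ} (𝓗 : Set (Matrix (Fin d) (Fin d) ℝ)) (h𝓗 : WellStructured 𝓗)
    (t : ℕ) (ht : 1 ≤ t) (g : Fin t → Fin d → ℝ)
    (G : Matrix (Fin d) (Fin t) ℝ) (hG : G = Matrix.of fun i s => g s i)
    (N : Matrix (Fin d) (Fin t) ℝ → ℝ)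
    (hN : ∀ W : Matrix (Fin d) (Fin t) ℝ,
      N W = sSup {r | ∃ H ∈ 𝓗, (t : ℝ) * H.trace ≤ 1 ∧ r = Real.sqrt ((Wᵀ * H * W).trace)}) :
    sInf {r | ∃ H ∈ 𝓗, H.PosDef ∧ H.trace ≤ 1 ∧
        r = Real.sqrt (∑ s : Fin t, g s ⬝ᵥ H⁻¹.mulVec (g s))} =
      (Real.sqrt t)⁻¹ *
        sSup {r | ∃ W : Matrix (Fin d) (Fin t) ℝ, N W ≤ 1 ∧ r = (Gᵀ * W).trace} := by
  obtain ⟨K', ⟨hsmul, hadd, -, hone⟩, rfl⟩ := h𝓗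
  obtain ⟨K, rfl⟩ : ∃ K : Submodule ℝ (Matrix (Fin d) (Fin d) ℝ), (K : Set _) = K' :=
    ⟨{ carrier := K'
       add_mem' := fun ha hb => hadd _ ha _ hb
       zero_mem' := by simpa using hsmul 0 1 hone
       smul_mem' := fun c _ ha => hsmul c _ ha }, rfl⟩
  have ht1 : (1 : ℝ) ≤ t := by exact_mod_cast ht
  have ht0 : (0 : ℝ) < t := by linarith
  have hsum : ∀ H : Matrix (Fin d) (Fin d) ℝ,
      ∑ s : Fin t, g s ⬝ᵥ H⁻¹.mulVec (g s) = (Gᵀ * H⁻¹ * G).trace := by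
    intro H
    rw [Matrix.mul_assoc, Matrix.trace]
    refine Finset.sum_congr rfl fun s _ => ?_
    subst hG
    rfl
  simp only [hsum]
  have hunit : ∀ W : Matrix (Fin d) (Fin t) ℝ, N W ≤ 1 ↔
      ∀ H ∈ K, H.PosSemidef → H.trace ≤ 1 → (Wᵀ * H * W).trace ≤ t := by
    intro W
    have hscale : ∀ c : ℝ, ∀ H : Matrix (Fin d) (Fin d) ℝ,
        (Wᵀ * (c • H) * W).trace = c * (Wᵀ * H * W).trace := by
      intro c H
      rw [Matrix.mul_smul, Matrix.smul_mul, Matrix.trace_smul, smul_eq_mul]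
    have hbdd : BddAbove {r | ∃ H ∈ (K : Set _) ∩ {M : Matrix (Fin d) (Fin d) ℝ | M.PosSemidef},
        (t : ℝ) * H.trace ≤ 1 ∧ r = Real.sqrt ((Wᵀ * H * W).trace)} := by
      refine (K.isCompact_posSemidef_trace_le_one.image
        (f := fun H => Real.sqrt ((Wᵀ * H * W).trace)) (by fun_prop)).bddAbove.mono ?_
      rintro r ⟨H, ⟨hK, hH : H.PosSemidef⟩, htr, rfl⟩
      exact ⟨H, ⟨hK, hH, by nlinarith [hH.trace_nonneg]⟩, rfl⟩
    rw [hN]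
    constructor
    · intro hle H hK hH htr
      have h := (le_csSup hbdd ⟨(t : ℝ)⁻¹ • H, ⟨K.smul_mem _ hK, hH.smul (by positivity)⟩,
        by simpa [Matrix.trace_smul, ht0.ne'] using htr, rfl⟩).trans hle
      rw [Real.sqrt_le_one, hscale, inv_mul_le_iff₀ ht0, mul_one] at h
      exact h
    · intro hle
      refine csSup_le ⟨_, 0, ⟨K.zero_mem, Matrix.PosSemidef.zero⟩, by simp, rfl⟩ ?_
      rintro r ⟨H, ⟨hK, hH : H.PosSemidef⟩, htr, rfl⟩
      have h := hle ((t : ℝ) • H) (K.smul_mem _ hK) (hH.smul ht0.le)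
        (by simpa [Matrix.trace_smul] using htr)
      rw [hscale] at h
      rw [Real.sqrt_le_one]
      nlinarith
  simp only [hunit]
  set S := {r | ∃ W : Matrix (Fin d) (Fin t) ℝ,
    (∀ H ∈ K, H.PosSemidef → H.trace ≤ 1 → (Wᵀ * H * W).trace ≤ t) ∧ r = (Gᵀ * W).trace}
  set T := {r | ∃ H ∈ (K : Set _) ∩ {M : Matrix (Fin d) (Fin d) ℝ | M.PosSemidef},
    H.PosDef ∧ H.trace ≤ 1 ∧ r = Real.sqrt ((Gᵀ * H⁻¹ * G).trace)}
  have hweak : ∀ r ∈ T, ∀ x ∈ S, x ≤ √t * r := by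
    rintro r ⟨H, ⟨hK, -⟩, hH, htr, rfl⟩ x ⟨W, hW, rfl⟩
    rw [← Real.sqrt_mul ht0.le]
    refine Real.le_sqrt_of_sq_le ((hH.trace_transpose_mul_sq_le G W).trans ?_)
    rw [mul_comm (t : ℝ)]
    exact mul_le_mul_of_nonneg_left (hW H hK hH.posSemidef htr)
      (hH.inv.posSemidef.trace_transpose_mul_mul_nonneg G)
  have hnormalize : ∀ A ∈ K, A.PosDef → ∀ b : ℝ, 0 < b → A.trace ≤ b →
      √(b * (Gᵀ * A⁻¹ * G).trace) ∈ T := by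
    intro A hK hA b hb htr
    have hpd : (b⁻¹ • A).PosDef := hA.smul (inv_pos.2 hb)
    refine ⟨b⁻¹ • A, ⟨K.smul_mem _ hK, hpd.posSemidef⟩, hpd, ?_, ?_⟩
    · rwa [Matrix.trace_smul, smul_eq_mul, inv_mul_le_iff₀ hb, mul_one]
    · have hinv : (b⁻¹ • A)⁻¹ = b • A⁻¹ := by
        refine Matrix.inv_eq_left_inv ?_
        rw [Matrix.smul_mul, Matrix.mul_smul, smul_smul, mul_inv_cancel₀ hb.ne', one_smul,
          Matrix.nonsing_inv_mul _ hA.det_pos.ne'.isUnit]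
      rw [hinv, Matrix.mul_smul, Matrix.smul_mul, Matrix.trace_smul, smul_eq_mul]
  have hTne : T.Nonempty :=
    ⟨_, hnormalize 1 hone Matrix.PosDef.one (d + 1) (by positivity) (by simp)⟩
  have hSzero : (0 : ℝ) ∈ S := ⟨0, by simp, by simp⟩
  have hSbdd : BddAbove S := hTne.elim fun r hr => ⟨√t * r, hweak r hr⟩
  have hTbdd : BddBelow T := ⟨0, by rintro r ⟨H, -, -, -, rfl⟩; exact Real.sqrt_nonneg _⟩
  have hsqrt : 0 < √(t : ℝ) := Real.sqrt_pos.2 ht0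
  refine le_antisymm ?_ ?_
  · have happrox : ∀ ε : ℝ, 0 < ε → sInf T ≤ √(1 + ε * d) * ((√t)⁻¹ * sSup S) := by
      intro ε hε
      obtain ⟨A, hK, hA, htr, hcert⟩ := K.exists_posDef_trace_inv_certificate hone G hε
      rw [Fintype.card_fin] at htr
      have hb : 0 < 1 + ε * d := by positivity
      refine (csInf_le hTbdd (hnormalize A hK hA _ hb htr)).trans ?_
      rw [Real.sqrt_mul hb.le]
      refine mul_le_mul_of_nonneg_left ?_ (Real.sqrt_nonneg _)
      rw [le_inv_mul_iff₀ hsqrt]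
      have hv := hA.inv.posSemidef.trace_transpose_mul_mul_nonneg G
      set v := (Gᵀ * A⁻¹ * G).trace with hvdef
      rcases hv.eq_or_lt with hv0 | hv0
      · rw [← hv0]
        simpa using le_csSup hSbdd hSzero
      refine le_csSup hSbdd ⟨(√t / √v) • (A⁻¹ * G), fun H hH hpsd htrH => ?_, ?_⟩
      · have h := hcert H hH hpsd htrH
        rw [Matrix.transpose_smul, Matrix.smul_mul, Matrix.smul_mul, Matrix.mul_smul,
          smul_smul, Matrix.trace_smul, smul_eq_mul, div_mul_div_comm, Real.mul_self_sqrt ht0.le,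
          Real.mul_self_sqrt hv]
        calc _ ≤ t / v * v := mul_le_mul_of_nonneg_left h (by positivity)
          _ = t := div_mul_cancel₀ _ hv0.ne'
      · rw [Matrix.mul_smul, Matrix.trace_smul, smul_eq_mul, ← Matrix.mul_assoc, ← hvdef,
          div_mul_eq_mul_div, mul_div_assoc, Real.div_sqrt]
    have hlim : Filter.Tendsto (fun ε : ℝ => √(1 + ε * d) * ((√t)⁻¹ * sSup S))
        (nhdsWithin 0 (Set.Ioi 0)) (nhds ((√t)⁻¹ * sSup S)) := by
      have h : Continuous fun ε : ℝ => √(1 + ε * d) * ((√t)⁻¹ * sSup S) := by fun_prop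
      simpa using (h.tendsto 0).mono_left nhdsWithin_le_nhds
    exact ge_of_tendsto hlim (eventually_mem_nhdsWithin.mono happrox)
  · refine le_csInf hTne fun r hr => ?_
    rw [inv_mul_le_iff₀ hsqrt]
    exact csSup_le ⟨0, hSzero⟩ (hweak r hr)
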